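/- Assume that all functions in N^{1,p}(X) are quasicontinuous. Let K_1 ⊃ K_2 ⊃ ⋯ be compact subsets of int E and let K = ⋂_{j=1}^∞ K_j. If p = 1, assume additionally that dist(K, X \ E) > 0. Then cap_p(K, E) = lim_{j→∞} cap_p(K_j, E). -/

import Mathlib

open MeasureTheory Metric Set Filter
open scoped ENNReal NNReal Topology

noncomputable section

variable {X : Type*} [MetricSpace X] [MeasurableSpace X] [BorelSpace X]

/-- A nonconstant, compact, rectifiable curve in `X`, parameterized by arc length on
`[0, len]`. The arc-length parameterization is expressed by requiring that the length
(total variation) of the curve on each subinterval `[s, t]` equals `t - s`. -/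
structure Curve (X : Type*) [MetricSpace X] where
  len : ℝ
  len_pos : 0 < len
  toFun : ℝ → X
  continuousOn : ContinuousOn toFun (Set.Icc 0 len)
  arclength : ∀ s t : ℝ, s ∈ Set.Icc 0 len → t ∈ Set.Icc 0 len → s ≤ t →
    eVariationOn toFun (Set.Icc s t) = ENNReal.ofReal (t - s)
  nonconstant : ∃ s ∈ Set.Icc 0 len, ∃ t ∈ Set.Icc 0 len, toFun s ≠ toFun t

/-- The curve integral `∫_γ g ds` of a nonnegative function along an arc-length
parameterized curve. -/
def Curve.integral (γ : Curve X) (g : X → ℝ≥0∞) : ℝ≥0∞ :=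
  ∫⁻ t in Set.Icc (0 : ℝ) γ.len, g (γ.toFun t)

/-- `|a - b|` with the convention that it is `∞` whenever both `a` and `b` are infinite. -/
def ugDiff (a b : EReal) : ℝ≥0∞ :=
  if a.abs = ⊤ ∨ b.abs = ⊤ then ⊤ else (a - b).abs

/-- The upper gradient inequality for `f` and `g` along the curve `γ`. -/
def UGOn (f : X → EReal) (g : X → ℝ≥0∞) (γ : Curve X) : Prop :=
  ugDiff (f (γ.toFun 0)) (f (γ.toFun γ.len)) ≤ γ.integral g

/-- A curve family has zero `p`-modulus. -/
def ZeroModulus (p : ℝ) (μ : Measure X) (Γ : Set (Curve X)) : Prop :=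
  ∃ ρ : X → ℝ≥0∞, Measurable ρ ∧ (∫⁻ x, ρ x ^ p ∂μ) < ⊤ ∧ ∀ γ ∈ Γ, γ.integral ρ = ⊤

/-- `g` is an upper gradient of `f`. -/
def IsUpperGradient (f : X → EReal) (g : X → ℝ≥0∞) : Prop :=
  Measurable g ∧ ∀ γ : Curve X, UGOn f g γ

/-- `g` is a `p`-weak upper gradient of `f`: the upper gradient inequality holds for
`p`-almost every curve. -/
def IsWeakUpperGradient (p : ℝ) (μ : Measure X) (f : X → EReal) (g : X → ℝ≥0∞) : Prop :=
  Measurable g ∧ ZeroModulus p μ {γ : Curve X | ¬ UGOn f g γ}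

/-- The energy `∫_X g_u^p dμ` of the minimal `p`-weak upper gradient of `u`, expressed as
the infimum of `∫_X g^p dμ` over all `p`-weak upper gradients `g` of `u`
(`= ∞` if `u` has no `p`-weak upper gradient). -/
def gradEnergy (p : ℝ) (μ : Measure X) (u : X → EReal) : ℝ≥0∞ :=
  ⨅ (g : X → ℝ≥0∞) (_ : IsWeakUpperGradient p μ u g), ∫⁻ x, g x ^ p ∂μ

/-- The Newtonian energy `‖u‖_{N^{1,p}(X)}^p = ∫_X |u|^p dμ + ∫_X g_u^p dμ`. -/
def newtonianEnergy (p : ℝ) (μ : Measure X) (u : X → EReal) : ℝ≥0∞ :=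
  (∫⁻ x, (u x).abs ^ p ∂μ) + gradEnergy p μ u

/-- Membership in the Newtonian space `N^{1,p}(X)` (measurability is with respect to the
completion of the Borel σ-algebra, i.e. a.e.-measurability). -/
def MemNewtonian (p : ℝ) (μ : Measure X) (u : X → EReal) : Prop :=
  AEMeasurable u μ ∧ newtonianEnergy p μ u < ⊤

/-- Membership in `N^{1,p}_0(E)`, members being regarded as functions on all of `X`
that vanish outside `E`. -/
def MemNewtonian0 (p : ℝ) (μ : Measure X) (E : Set X) (u : X → EReal) : Prop :=
  MemNewtonian p μ u ∧ ∀ x ∉ E, u x = 0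

/-- The Sobolev capacity `C_p(A)`. -/
def sobolevCapacity (p : ℝ) (μ : Measure X) (A : Set X) : ℝ≥0∞ :=
  ⨅ (u : X → EReal) (_ : MemNewtonian p μ u ∧ ∀ x ∈ A, u x = 1), newtonianEnergy p μ u

/-- The variational capacity `cap_p(A, E)`. -/
def varCapacity (p : ℝ) (μ : Measure X) (A E : Set X) : ℝ≥0∞ :=
  ⨅ (u : X → EReal) (_ : MemNewtonian0 p μ E u ∧ ∀ x ∈ A, 1 ≤ u x), gradEnergy p μ u

/-- A function is quasicontinuous if outside open sets of arbitrarily small Sobolev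
capacity it is real-valued and continuous. -/
def QuasicontinuousFun (p : ℝ) (μ : Measure X) (u : X → EReal) : Prop :=
  ∀ ε : ℝ≥0∞, 0 < ε → ∃ G : Set X, IsOpen G ∧ sobolevCapacity p μ G < ε ∧
    (∀ x ∈ Gᶜ, u x ≠ ⊤ ∧ u x ≠ ⊥) ∧ ContinuousOn u Gᶜ

/-- The capacity `~cap_p(A,E)`: the infimum of `cap_p(G,E)` over all relatively open
subsets `G` of `E` containing `A`. -/
def varCapacityT (p : ℝ) (μ : Measure X) (A E : Set X) : ℝ≥0∞ :=
  ⨅ (G : Set X) (_ : A ⊆ G ∧ G ⊆ E ∧ ∃ U : Set X, IsOpen U ∧ G = U ∩ E),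
    varCapacity p μ G E


set_option linter.unusedSectionVars false

/-- The truncation of an extended real to the unit interval. -/
def unitTrunc (a : EReal) : ℝ := (max 0 (min 1 a)).toReal

theorem unitTrunc_coe (a : ℝ) : unitTrunc a = max 0 (min 1 a) := by
  have h : (max 0 (min 1 (a : EReal))) = ((max 0 (min 1 a) : ℝ) : EReal) := by
    rw [EReal.coe_strictMono.monotone.map_max, EReal.coe_strictMono.monotone.map_min]
    rfl
  rw [unitTrunc, h, EReal.toReal_coe]

@[simp] theorem unitTrunc_top : unitTrunc ⊤ = 1 := by simp [unitTrunc]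

@[simp] theorem unitTrunc_bot : unitTrunc ⊥ = 0 := by simp [unitTrunc]

theorem unitTrunc_nonneg (a : EReal) : 0 ≤ unitTrunc a := by
  induction a <;> simp [unitTrunc_coe]

theorem unitTrunc_le_one (a : EReal) : unitTrunc a ≤ 1 := by
  induction a <;> simp [unitTrunc_coe]

theorem unitTrunc_zero : unitTrunc 0 = 0 := by simp [unitTrunc]

theorem unitTrunc_one : unitTrunc 1 = 1 := by simp [unitTrunc]

theorem measurable_unitTrunc : Measurable unitTrunc :=
  (measurable_const.max (measurable_const.min measurable_id)).ereal_toReal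

theorem le_unitTrunc_of_lt {θ : ℝ} (hθ : θ ≤ 1) {a : EReal} (h : (θ : EReal) < a) :
    θ ≤ unitTrunc a := by
  induction a with
  | bot => simp at h
  | top => simpa using hθ
  | coe a =>
    rw [unitTrunc_coe]
    exact le_max_of_le_right (le_min hθ (EReal.coe_lt_coe_iff.1 h).le)

theorem ofReal_unitTrunc_le_abs (a : EReal) : ENNReal.ofReal (unitTrunc a) ≤ a.abs := by
  induction a with
  | bot => simp
  | top => simp
  | coe a =>
    rw [unitTrunc_coe, EReal.abs_def]
    exact ENNReal.ofReal_le_ofReal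
      (max_le (abs_nonneg a) ((min_le_right _ _).trans (le_abs_self a)))

theorem ofReal_abs_unitTrunc_sub_le (a b : EReal) :
    ENNReal.ofReal |unitTrunc a - unitTrunc b| ≤ ugDiff a b := by
  induction a with
  | bot => simp [ugDiff]
  | top => simp [ugDiff]
  | coe a =>
    induction b with
    | bot => simp [ugDiff]
    | top => simp [ugDiff]
    | coe b =>
      rw [ugDiff, if_neg (by simp [(EReal.abs_coe_lt_top _).ne]), ← EReal.coe_sub, EReal.abs_def,
        unitTrunc_coe, unitTrunc_coe]
      refine ENNReal.ofReal_le_ofReal ?_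
      rw [max_comm 0, max_comm 0, min_comm 1, min_comm 1]
      refine (abs_max_sub_max_le_abs _ _ _).trans ((abs_min_sub_min_le_max _ _ _ _).trans ?_)
      simp

theorem ugOn_coe_iff {f : X → ℝ} {g : X → ℝ≥0∞} {γ : Curve X} :
    UGOn (fun x => (f x : EReal)) g γ ↔
      ENNReal.ofReal |f (γ.toFun 0) - f (γ.toFun γ.len)| ≤ γ.integral g := by
  rw [UGOn, ugDiff, if_neg (by simp [(EReal.abs_coe_lt_top _).ne]), ← EReal.coe_sub, EReal.abs_def]

namespace Curve

/-- The initial piece of length `t` of a curve. -/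
def initial {X : Type*} [MetricSpace X] (γ : Curve X) (t : ℝ) (ht : t ∈ Ioc 0 γ.len) :
    Curve X where
  len := t
  len_pos := ht.1
  toFun := γ.toFun
  continuousOn := γ.continuousOn.mono (Icc_subset_Icc_right ht.2)
  arclength a b ha hb := γ.arclength a b (Icc_subset_Icc_right ht.2 ha)
    (Icc_subset_Icc_right ht.2 hb)
  nonconstant := by
    by_contra! h
    have h0 : eVariationOn γ.toFun (Icc 0 t) = 0 :=
      eVariationOn.constant_on (by
        rintro _ ⟨a, ha, rfl⟩ _ ⟨b, hb, rfl⟩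
        exact h a ha b hb)
    rw [γ.arclength 0 t ⟨le_rfl, γ.len_pos.le⟩ ⟨ht.1.le, ht.2⟩ ht.1.le] at h0
    simp [ht.1.not_ge] at h0

theorem integral_initial_le (γ : Curve X) (t : ℝ) (ht : t ∈ Ioc 0 γ.len) (g : X → ℝ≥0∞) :
    (γ.initial t ht).integral g ≤ γ.integral g :=
  lintegral_mono_set (Icc_subset_Icc_right ht.2)

theorem integral_add_le (γ : Curve X) (g h : X → ℝ≥0∞) :
    γ.integral g + γ.integral h ≤ γ.integral (g + h) :=
  le_lintegral_add _ _

theorem const_mul_integral_le (γ : Curve X) (c : ℝ≥0∞) (g : X → ℝ≥0∞) :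
    c * γ.integral g ≤ γ.integral (fun x => c * g x) :=
  lintegral_const_mul_le _ _

theorem edist_endpoints_le (γ : Curve X) :
    edist (γ.toFun 0) (γ.toFun γ.len) ≤ ENNReal.ofReal γ.len := by
  have h := γ.arclength 0 γ.len ⟨le_rfl, γ.len_pos.le⟩ ⟨γ.len_pos.le, le_rfl⟩ γ.len_pos.le
  rw [sub_zero] at h
  rw [← h]
  exact eVariationOn.edist_le _ ⟨le_rfl, γ.len_pos.le⟩ ⟨γ.len_pos.le, le_rfl⟩

/-- A function oscillating by at most `I` from the initial point along a curve is controlled at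
that point by its average. -/
theorem tsub_mul_len_le_integral (γ : Curve X) {w : X → ℝ} {W : X → ℝ≥0∞} {I : ℝ≥0∞}
    (hW : ∀ x, ENNReal.ofReal (w x) ≤ W x)
    (hI : ∀ t ∈ Ioc 0 γ.len, ENNReal.ofReal |w (γ.toFun 0) - w (γ.toFun t)| ≤ I) :
    (ENNReal.ofReal (w (γ.toFun 0)) - I) * ENNReal.ofReal γ.len ≤ γ.integral W := by
  have hc : ∫⁻ _ in Icc (0 : ℝ) γ.len, (ENNReal.ofReal (w (γ.toFun 0)) - I) =
      (ENNReal.ofReal (w (γ.toFun 0)) - I) * ENNReal.ofReal γ.len := by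
    rw [setLIntegral_const, Real.volume_Icc, sub_zero]
  rw [← hc]
  refine setLIntegral_mono' measurableSet_Icc fun t ht => ?_
  rw [tsub_le_iff_right]
  rcases ht.1.eq_or_lt with h0 | h0
  · rw [← h0]
    exact (hW _).trans le_self_add
  · calc ENNReal.ofReal (w (γ.toFun 0))
        ≤ ENNReal.ofReal (w (γ.toFun t) + |w (γ.toFun 0) - w (γ.toFun t)|) :=
          ENNReal.ofReal_le_ofReal (by linarith [le_abs_self (w (γ.toFun 0) - w (γ.toFun t))])
      _ ≤ ENNReal.ofReal (w (γ.toFun t)) + ENNReal.ofReal |w (γ.toFun 0) - w (γ.toFun t)| :=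
          ENNReal.ofReal_add_le
      _ ≤ W (γ.toFun t) + I := add_le_add (hW _) (hI t ⟨h0, ht.2⟩)

/-- A Leibniz-type estimate for the product with a Lipschitz cutoff function. -/
theorem ofReal_abs_mul_sub_le (γ : Curve X) {η w : X → ℝ} {W : X → ℝ≥0∞} {I : ℝ≥0∞} {L : ℝ≥0}
    (hη0 : ∀ x, 0 ≤ η x) (hη1 : ∀ x, η x ≤ 1) (hηL : LipschitzWith L η) (hw : ∀ x, 0 ≤ w x)
    (hW : ∀ x, ENNReal.ofReal (w x) ≤ W x)
    (hI : ∀ t ∈ Ioc 0 γ.len, ENNReal.ofReal |w (γ.toFun 0) - w (γ.toFun t)| ≤ I) :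
    ENNReal.ofReal |η (γ.toFun 0) * w (γ.toFun 0) - η (γ.toFun γ.len) * w (γ.toFun γ.len)| ≤
      2 * I + L * γ.integral W := by
  set x := γ.toFun 0
  set y := γ.toFun γ.len
  set m : ℝ≥0∞ := ENNReal.ofReal |η x - η y|
  have hm1 : m ≤ 1 := by
    rw [← ENNReal.ofReal_one]
    refine ENNReal.ofReal_le_ofReal (abs_le.2 ⟨?_, ?_⟩)
    · linarith [hη0 x, hη1 y]
    · linarith [hη0 y, hη1 x]
  have hmL : m ≤ L * ENNReal.ofReal γ.len := by
    have h : m = edist (η x) (η y) := by rw [edist_dist, Real.dist_eq]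
    rw [h]
    exact (hηL x y).trans (mul_le_mul_right γ.edist_endpoints_le _)
  have hprod : ENNReal.ofReal |η x * w x - η y * w y| ≤
      ENNReal.ofReal |w x - w y| + m * ENNReal.ofReal (w x) := by
    rw [← ENNReal.ofReal_mul (abs_nonneg _), ← ENNReal.ofReal_add (abs_nonneg _)
      (mul_nonneg (abs_nonneg _) (hw x))]
    refine ENNReal.ofReal_le_ofReal ?_
    have h : η x * w x - η y * w y = η y * (w x - w y) + (η x - η y) * w x := by ring
    rw [h]
    refine (abs_add_le _ _).trans (add_le_add ?_ ?_)
    · rw [abs_mul, abs_of_nonneg (hη0 y)]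
      exact mul_le_of_le_one_left (abs_nonneg _) (hη1 y)
    · rw [abs_mul, abs_of_nonneg (hw x)]
  have havg := γ.tsub_mul_len_le_integral hW hI
  calc ENNReal.ofReal |η x * w x - η y * w y|
      ≤ ENNReal.ofReal |w x - w y| + m * ENNReal.ofReal (w x) := hprod
    _ ≤ I + m * (I + (ENNReal.ofReal (w x) - I)) :=
        add_le_add (hI _ ⟨γ.len_pos, le_rfl⟩) (mul_le_mul_right le_add_tsub _)
    _ = I + (m * I + m * (ENNReal.ofReal (w x) - I)) := by rw [mul_add]
    _ ≤ I + (1 * I + L * ENNReal.ofReal γ.len * (ENNReal.ofReal (w x) - I)) := by gcongr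
    _ = 2 * I + L * ((ENNReal.ofReal (w x) - I) * ENNReal.ofReal γ.len) := by ring
    _ ≤ 2 * I + L * γ.integral W := by gcongr

end Curve

/-- A weak upper gradient inequality holds on all initial pieces of almost every curve. -/
theorem ofReal_abs_unitTrunc_sub_initial_le {u : X → EReal} {g ρ : X → ℝ≥0∞} {γ : Curve X}
    (hρ : ∀ γ ∈ {γ : Curve X | ¬ UGOn u g γ}, γ.integral ρ = ⊤) (hγ : γ.integral ρ ≠ ⊤) :
    ∀ t ∈ Ioc 0 γ.len,
      ENNReal.ofReal |unitTrunc (u (γ.toFun 0)) - unitTrunc (u (γ.toFun t))| ≤ γ.integral g := by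
  intro t ht
  refine (ofReal_abs_unitTrunc_sub_le _ _).trans (le_trans ?_ (γ.integral_initial_le t ht g))
  by_contra h
  exact hγ (top_le_iff.1 ((hρ (γ.initial t ht) h).ge.trans (γ.integral_initial_le t ht ρ)))

theorem lintegral_const_mul_rpow_rpow_inv {α : Type*} [MeasurableSpace α] {μ : Measure α} {p : ℝ}
    (hp : 0 < p) {c : ℝ≥0∞} (hc : c ≠ ⊤) (f : α → ℝ≥0∞) :
    (∫⁻ x, (c * f x) ^ p ∂μ) ^ (1 / p) = c * (∫⁻ x, f x ^ p ∂μ) ^ (1 / p) := by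
  simp_rw [ENNReal.mul_rpow_of_nonneg _ _ hp.le]
  rw [lintegral_const_mul' _ _ (ENNReal.rpow_ne_top_of_nonneg hp.le hc),
    ENNReal.mul_rpow_of_nonneg _ _ (by positivity), ← ENNReal.rpow_mul,
    mul_one_div_cancel hp.ne', ENNReal.rpow_one]

theorem exists_measurable_ge_ae_eq {α : Type*} [MeasurableSpace α] {μ : Measure α}
    {f : α → ℝ≥0∞} (hf : AEMeasurable f μ) : ∃ F, Measurable F ∧ f ≤ F ∧ F =ᵐ[μ] f := by
  classical
  set N := toMeasurable μ {x | f x ≠ hf.mk f x}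
  have hN : μ N = 0 := by rw [measure_toMeasurable]; exact hf.ae_eq_mk
  refine ⟨N.piecewise (fun _ => ⊤) (hf.mk f),
    measurable_const.piecewise (measurableSet_toMeasurable _ _) hf.measurable_mk, fun x => ?_, ?_⟩
  · by_cases hx : x ∈ N
    · simp [hx]
    · have : f x = hf.mk f x := by
        by_contra h
        exact hx (subset_toMeasurable _ _ h)
      simp [hx, this]
  · have h1 : ∀ᵐ x ∂μ, x ∉ N := measure_eq_zero_iff_ae_notMem.1 hN
    filter_upwards [h1, hf.ae_eq_mk] with x hx h
    simp [hx, h]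

/-- Correcting a truncated function by a cut-off function of small norm gives a function
admissible for the variational capacity of a larger set. -/
theorem varCapacity_rpow_inv_le {p : ℝ} (hp : 1 ≤ p) {μ : Measure X} {A E : Set X}
    {u w : X → EReal} {g h : X → ℝ≥0∞} {η : X → ℝ} {L : ℝ≥0} {θ : ℝ} (hθ : 0 < θ)
    (hu : MemNewtonian0 p μ E u) (hg : IsWeakUpperGradient p μ u g)
    (hgfin : ∫⁻ x, g x ^ p ∂μ < ⊤)
    (hw : MemNewtonian p μ w) (hh : IsWeakUpperGradient p μ w h)
    (hhfin : ∫⁻ x, h x ^ p ∂μ < ⊤)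
    (hη0 : ∀ x, 0 ≤ η x) (hη1 : ∀ x, η x ≤ 1) (hηL : LipschitzWith L η)
    (hηE : ∀ x ∉ E, η x = 0)
    (hA : ∀ x ∈ A, η x = 1 ∧ (θ ≤ unitTrunc (u x) ∨ w x = 1)) :
    varCapacity p μ A E ^ (1 / p) ≤
      ENNReal.ofReal θ⁻¹ * (∫⁻ x, g x ^ p ∂μ) ^ (1 / p) +
        (2 * (∫⁻ x, h x ^ p ∂μ) ^ (1 / p) + L * (∫⁻ x, (w x).abs ^ p ∂μ) ^ (1 / p)) := by
  have hp0 : 0 < p := by linarith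
  have hpi : 0 < 1 / p := by positivity
  have hθi : 0 ≤ θ⁻¹ := by positivity
  have hum : AEMeasurable (fun x => unitTrunc (u x)) μ :=
    measurable_unitTrunc.comp_aemeasurable hu.1.1
  have hwm : AEMeasurable (fun x => unitTrunc (w x)) μ :=
    measurable_unitTrunc.comp_aemeasurable hw.1
  have hufin : ∫⁻ x, (u x).abs ^ p ∂μ < ⊤ := lt_of_le_of_lt le_self_add hu.1.2
  have hwfin : ∫⁻ x, (w x).abs ^ p ∂μ < ⊤ := lt_of_le_of_lt le_self_add hw.2
  obtain ⟨W, hWm, hWge, hWae⟩ := exists_measurable_ge_ae_eq hwm.ennreal_ofReal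
  have hWint : ∫⁻ x, W x ^ p ∂μ ≤ ∫⁻ x, (w x).abs ^ p ∂μ := by
    refine lintegral_mono_ae ?_
    filter_upwards [hWae] with x hx
    rw [hx]
    exact ENNReal.rpow_le_rpow (ofReal_unitTrunc_le_abs _) hp0.le
  set v : X → ℝ := fun x => θ⁻¹ * unitTrunc (u x) + η x * unitTrunc (w x) with hv
  set G : X → ℝ≥0∞ := (fun x => ENNReal.ofReal θ⁻¹ * g x) +
    ((fun x => 2 * h x) + fun x => (L : ℝ≥0∞) * W x) with hG
  have hG1 : Measurable fun x => ENNReal.ofReal θ⁻¹ * g x := hg.1.const_mul _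
  have hG2 : Measurable fun x => 2 * h x := hh.1.const_mul _
  have hG3 : Measurable fun x => (L : ℝ≥0∞) * W x := hWm.const_mul _
  have hGbound : (∫⁻ x, G x ^ p ∂μ) ^ (1 / p) ≤
      ENNReal.ofReal θ⁻¹ * (∫⁻ x, g x ^ p ∂μ) ^ (1 / p) +
        (2 * (∫⁻ x, h x ^ p ∂μ) ^ (1 / p) + L * (∫⁻ x, (w x).abs ^ p ∂μ) ^ (1 / p)) := by
    refine (ENNReal.lintegral_Lp_add_le hG1.aemeasurable (hG2.add hG3).aemeasurable hp).trans ?_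
    rw [lintegral_const_mul_rpow_rpow_inv hp0 ENNReal.ofReal_ne_top]
    refine add_le_add_right
      ((ENNReal.lintegral_Lp_add_le hG2.aemeasurable hG3.aemeasurable hp).trans ?_) _
    rw [lintegral_const_mul_rpow_rpow_inv hp0 (by simp),
      lintegral_const_mul_rpow_rpow_inv hp0 ENNReal.coe_ne_top]
    gcongr
  have hGwug : IsWeakUpperGradient p μ (fun x => (v x : EReal)) G := by
    refine ⟨hG1.add (hG2.add hG3), ?_⟩
    obtain ⟨ρ₁, hρ₁m, hρ₁fin, hρ₁⟩ := hg.2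
    obtain ⟨ρ₂, hρ₂m, hρ₂fin, hρ₂⟩ := hh.2
    refine ⟨ρ₁ + ρ₂, hρ₁m.add hρ₂m,
      ENNReal.lintegral_rpow_add_lt_top_of_lintegral_rpow_lt_top hρ₁m.aemeasurable
        hρ₁fin hρ₂fin hp, fun γ hγ => ?_⟩
    by_contra hfin
    refine hγ (ugOn_coe_iff.2 ?_)
    have h₁ : γ.integral ρ₁ ≠ ⊤ :=
      ne_top_of_le_ne_top hfin (le_self_add.trans (γ.integral_add_le ρ₁ ρ₂))
    have h₂ : γ.integral ρ₂ ≠ ⊤ :=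
      ne_top_of_le_ne_top hfin (le_add_self.trans (γ.integral_add_le ρ₁ ρ₂))
    have hug := ofReal_abs_unitTrunc_sub_initial_le hρ₁ h₁ γ.len ⟨γ.len_pos, le_rfl⟩
    have hwg := γ.ofReal_abs_mul_sub_le hη0 hη1 hηL (fun x => unitTrunc_nonneg (w x)) hWge
      (ofReal_abs_unitTrunc_sub_initial_le hρ₂ h₂)
    set x := γ.toFun 0
    set y := γ.toFun γ.len
    calc ENNReal.ofReal |v x - v y|
        ≤ ENNReal.ofReal (θ⁻¹ * |unitTrunc (u x) - unitTrunc (u y)| +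
            |η x * unitTrunc (w x) - η y * unitTrunc (w y)|) := by
          refine ENNReal.ofReal_le_ofReal ?_
          have e : v x - v y = θ⁻¹ * (unitTrunc (u x) - unitTrunc (u y)) +
              (η x * unitTrunc (w x) - η y * unitTrunc (w y)) := by simp only [hv]; ring
          rw [e]
          refine (abs_add_le _ _).trans_eq ?_
          rw [abs_mul, abs_of_nonneg hθi]
      _ ≤ ENNReal.ofReal θ⁻¹ * γ.integral g + (2 * γ.integral h + L * γ.integral W) := by
          refine ENNReal.ofReal_add_le.trans ?_
          rw [ENNReal.ofReal_mul hθi]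
          exact add_le_add (mul_le_mul_right hug _) hwg
      _ ≤ γ.integral G := by
          refine le_trans (add_le_add (γ.const_mul_integral_le _ _) (le_trans (add_le_add
            (γ.const_mul_integral_le _ _) (γ.const_mul_integral_le _ _))
            (γ.integral_add_le _ _))) (γ.integral_add_le _ _)
  have hGfin : ∫⁻ x, G x ^ p ∂μ < ⊤ := by
    rw [← ENNReal.rpow_lt_top_iff_of_pos hpi]
    refine hGbound.trans_lt ?_
    have f1 := (ENNReal.rpow_lt_top_iff_of_pos hpi).2 hgfin
    have f2 := (ENNReal.rpow_lt_top_iff_of_pos hpi).2 hhfin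
    have f3 := (ENNReal.rpow_lt_top_iff_of_pos hpi).2 hwfin
    exact ENNReal.add_lt_top.2 ⟨ENNReal.mul_lt_top ENNReal.ofReal_lt_top f1,
      ENNReal.add_lt_top.2 ⟨ENNReal.mul_lt_top (by simp) f2,
        ENNReal.mul_lt_top ENNReal.coe_lt_top f3⟩⟩
  have hEnergy : gradEnergy p μ (fun x => (v x : EReal)) ≤ ∫⁻ x, G x ^ p ∂μ :=
    iInf₂_le G hGwug
  have hvm : AEMeasurable v μ :=
    (hum.const_mul _).add (hηL.continuous.measurable.aemeasurable.mul hwm)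
  have hvnorm : ∫⁻ x, (v x : EReal).abs ^ p ∂μ < ⊤ := by
    refine lt_of_le_of_lt (b := ∫⁻ x, ((fun x => ENNReal.ofReal θ⁻¹ * ENNReal.ofReal
      (unitTrunc (u x))) + fun x => ENNReal.ofReal (unitTrunc (w x))) x ^ p ∂μ)
      (lintegral_mono fun x => ENNReal.rpow_le_rpow ?_ hp0.le)
      (ENNReal.lintegral_rpow_add_lt_top_of_lintegral_rpow_lt_top
        (hum.ennreal_ofReal.const_mul _) ?_ ?_ hp)
    · have a1 := mul_nonneg hθi (unitTrunc_nonneg (u x))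
      have a2 := mul_nonneg (hη0 x) (unitTrunc_nonneg (w x))
      rw [EReal.abs_def, Pi.add_apply, ← ENNReal.ofReal_mul hθi,
        ← ENNReal.ofReal_add a1 (unitTrunc_nonneg _), abs_of_nonneg (add_nonneg a1 a2)]
      exact ENNReal.ofReal_le_ofReal (add_le_add_right
        (mul_le_of_le_one_left (unitTrunc_nonneg _) (hη1 x)) _)
    · rw [← ENNReal.rpow_lt_top_iff_of_pos hpi,
        lintegral_const_mul_rpow_rpow_inv hp0 ENNReal.ofReal_ne_top]
      refine ENNReal.mul_lt_top ENNReal.ofReal_lt_top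
        ((ENNReal.rpow_lt_top_iff_of_pos hpi).2 (lt_of_le_of_lt (lintegral_mono fun x => ?_) hufin))
      exact ENNReal.rpow_le_rpow (ofReal_unitTrunc_le_abs _) hp0.le
    · refine lt_of_le_of_lt (lintegral_mono fun x => ?_) hwfin
      exact ENNReal.rpow_le_rpow (ofReal_unitTrunc_le_abs _) hp0.le
  have hadm : MemNewtonian0 p μ E (fun x => (v x : EReal)) ∧ ∀ x ∈ A, 1 ≤ (v x : EReal) := by
    refine ⟨⟨⟨hvm.coe_real_ereal, ENNReal.add_lt_top.2 ⟨hvnorm, hEnergy.trans_lt hGfin⟩⟩,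
      fun x hx => ?_⟩, fun x hx => ?_⟩
    · simp [hv, hu.2 x hx, unitTrunc_zero, hηE x hx]
    · rw [← EReal.coe_one, EReal.coe_le_coe_iff]
      obtain ⟨h1, h2 | h2⟩ := hA x hx
      · have : 1 ≤ θ⁻¹ * unitTrunc (u x) := by
          rw [← inv_mul_cancel₀ hθ.ne']
          exact mul_le_mul_of_nonneg_left h2 hθi
        have a2 := mul_nonneg (hη0 x) (unitTrunc_nonneg (w x))
        simp only [hv]
        linarith
      · have a1 := mul_nonneg hθi (unitTrunc_nonneg (u x))
        simp only [hv, h1, h2, unitTrunc_one]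
        linarith
  have hcap : varCapacity p μ A E ≤ ∫⁻ x, G x ^ p ∂μ :=
    (iInf₂_le (fun x => (v x : EReal)) hadm).trans hEnergy
  exact (ENNReal.rpow_le_rpow hcap hpi.le).trans hGbound

theorem varCapacity_mono {p : ℝ} {μ : Measure X} {A B E : Set X} (hAB : A ⊆ B) :
    varCapacity p μ A E ≤ varCapacity p μ B E :=
  le_iInf₂ fun u hu => iInf₂_le u ⟨hu.1, fun x hx => hu.2 x (hAB hx)⟩

theorem exists_lipschitz_cutoff {K U : Set X} (hK : IsCompact K) (hU : IsOpen U) (hKU : K ⊆ U) :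
    ∃ (η : X → ℝ) (L : ℝ≥0), (∀ x, 0 ≤ η x) ∧ (∀ x, η x ≤ 1) ∧ LipschitzWith L η ∧
      (∀ x ∉ U, η x = 0) ∧ ∀ x ∈ K, η x = 1 := by
  obtain ⟨δ, hδ, hsub⟩ := hK.exists_thickening_subset_open hU hKU
  refine ⟨fun x => thickenedIndicator hδ K x, δ.toNNReal⁻¹, fun x => NNReal.coe_nonneg _,
    fun x => ?_, fun x y => ?_, fun x hx => ?_, fun x hx => ?_⟩
  · exact_mod_cast thickenedIndicator_le_one hδ K x
  · exact lipschitzWith_thickenedIndicator hδ K x y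
  · simp [thickenedIndicator_zero hδ K fun h => hx (hsub h)]
  · simp [thickenedIndicator_one hδ K hx]

/-- If `u` is admissible for `⋂ j, K j`, then the capacity of some `K j` is, up to an arbitrarily
small error, at most that of the rescaled function `θ⁻¹ u`, for every level `θ < 1`. -/
theorem exists_varCapacity_rpow_inv_le {p : ℝ} (hp : 1 ≤ p) {μ : Measure X}
    (hqc : ∀ u : X → EReal, MemNewtonian p μ u → QuasicontinuousFun p μ u)
    {E : Set X} {K : ℕ → Set X} (hK : ∀ j, IsCompact (K j)) (hKint : ∀ j, K j ⊆ interior E)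
    (hanti : Antitone K) {u : X → EReal} (hu : MemNewtonian0 p μ E u)
    (huK : ∀ x ∈ ⋂ j, K j, 1 ≤ u x) {g : X → ℝ≥0∞} (hg : IsWeakUpperGradient p μ u g)
    (hgfin : ∫⁻ x, g x ^ p ∂μ < ⊤) {θ : ℝ} (hθ : 0 < θ) (hθ1 : θ < 1) {τ : ℝ≥0} (hτ : 0 < τ) :
    ∃ j, varCapacity p μ (K j) E ^ (1 / p) ≤
      ENNReal.ofReal θ⁻¹ * (∫⁻ x, g x ^ p ∂μ) ^ (1 / p) + τ := by
  have hp0 : 0 < p := by linarith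
  obtain ⟨η, L, hη0, hη1, hηL, hηE, hηK⟩ :=
    exists_lipschitz_cutoff (hK 0) isOpen_interior (hKint 0)
  set σ : ℝ≥0 := τ / (2 + L)
  have hσ : 0 < σ := by positivity
  have hσp : (0 : ℝ≥0∞) < (σ : ℝ≥0∞) ^ p :=
    ENNReal.rpow_pos (by exact_mod_cast hσ) ENNReal.coe_ne_top
  obtain ⟨G, hGo, hGcap, -, hGcont⟩ := hqc u hu.1 _ hσp
  obtain ⟨w, ⟨hw, hwG⟩, hwlt⟩ : ∃ w : X → EReal, (MemNewtonian p μ w ∧ ∀ x ∈ G, w x = 1) ∧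
      newtonianEnergy p μ w < (σ : ℝ≥0∞) ^ p := by
    simpa only [sobolevCapacity, iInf_lt_iff, exists_prop] using hGcap
  obtain ⟨h, hh, hhlt⟩ : ∃ h : X → ℝ≥0∞, IsWeakUpperGradient p μ w h ∧
      ∫⁻ x, h x ^ p ∂μ < (σ : ℝ≥0∞) ^ p := by
    have : gradEnergy p μ w < (σ : ℝ≥0∞) ^ p := lt_of_le_of_lt le_add_self hwlt
    simpa only [gradEnergy, iInf_lt_iff, exists_prop] using this
  have hVo : IsOpen (G ∪ {x | (θ : EReal) < u x}) := by
    have hc : IsClosed (Gᶜ ∩ u ⁻¹' Iic (θ : EReal)) :=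
      hGcont.preimage_isClosed_of_isClosed hGo.isClosed_compl isClosed_Iic
    convert hc.isOpen_compl using 1
    ext x
    by_cases hx : x ∈ G <;> simp [hx]
  have hVK : ∀ x ∈ ⋂ j, K j, G ∪ {x | (θ : EReal) < u x} ∈ 𝓝 x := fun x hx =>
    hVo.mem_nhds (Or.inr (lt_of_lt_of_le (by exact_mod_cast hθ1) (huK x hx)))
  obtain ⟨j, hj⟩ := exists_subset_nhds_of_isCompact hanti.directed_ge hK hVK
  refine ⟨j, (varCapacity_rpow_inv_le hp hθ hu hg hgfin hw hh (hhlt.trans_le le_top) hη0 hη1 hηL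
    (fun x hx => hηE x fun hxE => hx (interior_subset hxE)) fun x hx =>
      ⟨hηK x (hanti (Nat.zero_le j) hx), (hj hx).symm.imp (le_unitTrunc_of_lt hθ1.le) (hwG x)⟩).trans
    (add_le_add_right ?_ _)⟩
  have hroot : ∀ a : ℝ≥0∞, a ≤ (σ : ℝ≥0∞) ^ p → a ^ (1 / p) ≤ σ := fun a ha => by
    rw [one_div]
    exact (ENNReal.rpow_inv_le_iff hp0).2 ha
  calc 2 * (∫⁻ x, h x ^ p ∂μ) ^ (1 / p) + L * (∫⁻ x, (w x).abs ^ p ∂μ) ^ (1 / p)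
      ≤ 2 * (σ : ℝ≥0∞) + L * σ :=
        add_le_add (mul_le_mul_right (hroot _ hhlt.le) _)
          (mul_le_mul_right (hroot _ (le_self_add.trans hwlt.le)) _)
    _ = ((σ * (2 + L) : ℝ≥0) : ℝ≥0∞) := by push_cast; ring
    _ = τ := by rw [div_mul_cancel₀ _ (by positivity)]

/-- Continuity of `cap_p` on decreasing sequences of compact subsets of
`int E` (with an extra distance assumption when `p = 1`). -/
theorem stmt_14 (p : ℝ) (hp : 1 ≤ p) (μ : Measure X)
    (hball : ∀ (x : X) (r : ℝ), 0 < r → 0 < μ (Metric.ball x r) ∧ μ (Metric.ball x r) < ⊤)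
    (hqc : ∀ u : X → EReal, MemNewtonian p μ u → QuasicontinuousFun p μ u)
    (E : Set X) (hE : Bornology.IsBounded E)
    (K : ℕ → Set X) (hK : ∀ j, IsCompact (K j)) (hKint : ∀ j, K j ⊆ interior E)
    (hmono : ∀ j, K (j + 1) ⊆ K j)
    (hp1 : p = 1 → ∃ d : ℝ, 0 < d ∧ ∀ x ∈ ⋂ j, K j, ∀ y ∉ E, d ≤ dist x y) :
    Filter.Tendsto (fun j => varCapacity p μ (K j) E) Filter.atTop
      (𝓝 (varCapacity p μ (⋂ j, K j) E)) := by
  have hp0 : 0 < p := by linarith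
  have hpi : 0 < 1 / p := by positivity
  have hanti : Antitone K := antitone_nat_of_succ_le hmono
  have hcap : Antitone fun j => varCapacity p μ (K j) E := fun i j hij =>
    varCapacity_mono (hanti hij)
  have hlim : ⨅ j, varCapacity p μ (K j) E = varCapacity p μ (⋂ j, K j) E := by
    refine le_antisymm ?_ (le_iInf fun j => varCapacity_mono (iInter_subset K j))
    refine le_iInf₂ fun u hu => le_iInf₂ fun g hg => ?_
    rcases eq_or_ne (∫⁻ x, g x ^ p ∂μ) ⊤ with htop | htop
    · rw [htop]
      exact le_top
    rw [← ENNReal.rpow_le_rpow_iff hpi]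
    refine ENNReal.le_of_forall_lt_one_mul_le fun a ha => ?_
    rcases eq_or_ne a 0 with rfl | ha0
    · simp
    lift a to ℝ≥0 using ha.ne_top
    have ha1 : a < 1 := by exact_mod_cast ha
    have hapos : 0 < a := pos_iff_ne_zero.2 (by exact_mod_cast ha0)
    have hinv : ENNReal.ofReal (a : ℝ)⁻¹ = (a : ℝ≥0∞)⁻¹ := by
      rw [ENNReal.ofReal_inv_of_pos (by exact_mod_cast hapos), ENNReal.ofReal_coe_nnreal]
    have key : (⨅ j, varCapacity p μ (K j) E) ^ (1 / p) ≤
        (a : ℝ≥0∞)⁻¹ * (∫⁻ x, g x ^ p ∂μ) ^ (1 / p) := by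
      refine ENNReal.le_of_forall_pos_le_add fun τ hτ _ => ?_
      obtain ⟨j, hj⟩ := exists_varCapacity_rpow_inv_le hp hqc hK hKint hanti hu.1 hu.2 hg
        htop.lt_top (θ := a) (by exact_mod_cast hapos) (by exact_mod_cast ha1) hτ
      rw [hinv] at hj
      exact (ENNReal.rpow_le_rpow (iInf_le _ j) hpi.le).trans hj
    refine (mul_le_mul_right key _).trans_eq ?_
    rw [← mul_assoc, ENNReal.mul_inv_cancel ha0 ENNReal.coe_ne_top, one_mul]
  rw [← hlim]
  exact tendsto_atTop_iInf hcap

end
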